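/- arXiv:1308.1264 — 2 statements merged into one kernel-verified Lean document; each statement's English description precedes it below -/
import Mathlib

section
/- Let p > 1, 1/p + 1/q = 1, σ > 1, and let f : (0,∞) → [0,∞) be measurable with 0 < ∫₀^∞ x^{p(1−σ)−1} f(x)^p dx < ∞. Then (∫₀^∞ y^{−pσ−1} (∫₀^∞ (coth(x/y) − 1) f(x) dx)^p dy)^{1/p} < (Γ(σ)/2^{σ−1}) ζ(σ) · (∫₀^∞ x^{p(1−σ)−1} f(x)^p dx)^{1/p}. -/
open MeasureTheory Real Set

noncomputable def cothR (v : ℝ) : ℝ := (Real.exp v + Real.exp (-v)) / (Real.exp v - Real.exp (-v))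
noncomputable def zetaR (σ : ℝ) : ℝ := ∑' k : ℕ+, (k : ℝ) ^ (-σ)

lemma hasSum_cothR_sub_one {v : ℝ} (hv : 0 < v) :
    HasSum (fun k : ℕ+ => 2 * exp (-(2 * k * v))) (cothR v - 1) := by
  have h1 : exp (-(2 * v)) < 1 := exp_lt_one_iff.2 (by linarith)
  have h2 := ((hasSum_geometric_of_lt_one (exp_pos _).le h1).mul_left
    (2 * exp (-(2 * v))))
  rw [← Equiv.pnatEquivNat.symm.hasSum_iff]
  have h4 : exp v - exp (-v) ≠ 0 := (sub_pos.2 (exp_lt_exp.2 (by linarith))).ne'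
  have h3 : cothR v - 1 = 2 * exp (-(2 * v)) * (1 - exp (-(2 * v)))⁻¹ := by
    have h5 : exp (-(2 * v)) = exp (-v) / exp v := by rw [← exp_sub]; ring_nf
    have h6 := exp_pos v
    rw [cothR, h5]
    field_simp
    ring
  rw [h3]
  convert! h2 using 2 with n
  simp only [Function.comp, Equiv.pnatEquivNat_symm_apply, Nat.succPNat_coe, Nat.succ_eq_add_one]
  rw [← exp_nat_mul, mul_assoc 2 (exp _) (exp _), ← exp_add]
  push_cast
  ring_nf

lemma cothR_sub_one_pos {v : ℝ} (hv : 0 < v) : 0 < cothR v - 1 := by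
  rw [cothR, sub_pos, one_lt_div (sub_pos.2 (exp_lt_exp.2 (by linarith)))]
  linarith [exp_pos (-v)]

lemma summable_pnat_rpow_neg {σ : ℝ} (hσ : 1 < σ) : Summable fun k : ℕ+ => (k : ℝ) ^ (-σ) :=
  (summable_nat_rpow.2 (by linarith)).comp_injective PNat.coe_injective

lemma zetaR_pos {σ : ℝ} (hσ : 1 < σ) : 0 < zetaR σ :=
  (summable_pnat_rpow_neg hσ).tsum_pos (fun k => by positivity) 1 (by simp)

lemma lintegral_cothR_sub_one_mul_rpow {σ : ℝ} (hσ : 1 < σ) :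
    ∫⁻ v in Ioi (0 : ℝ), ENNReal.ofReal (v ^ (σ - 1) * (cothR v - 1)) =
      ENNReal.ofReal (Gamma σ / 2 ^ (σ - 1) * zetaR σ) := by
  have hσ0 : 0 < σ := by linarith
  have hterm : ∀ k : ℕ+, ∫⁻ v in Ioi (0 : ℝ),
      ENNReal.ofReal (v ^ (σ - 1) * (2 * exp (-(2 * k * v)))) =
        ENNReal.ofReal (Gamma σ / 2 ^ (σ - 1) * (k : ℝ) ^ (-σ)) := by
    intro k
    have hk : (0 : ℝ) < 2 * k := by positivity
    have hval := integral_rpow_mul_exp_neg_mul_Ioi hσ0 hk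
    have hint : IntegrableOn (fun v : ℝ => v ^ (σ - 1) * exp (-(2 * k * v))) (Ioi 0) := by
      refine not_imp_comm.1 integral_undef ?_
      rw [hval]
      have := Gamma_pos_of_pos hσ0
      positivity
    have hint2 : IntegrableOn (fun v : ℝ => v ^ (σ - 1) * (2 * exp (-(2 * k * v)))) (Ioi 0) :=
      (hint.const_mul 2).congr (.of_forall fun v => by ring)
    rw [← ofReal_integral_eq_lintegral_ofReal hint2]
    · congr 1
      have : ∀ v : ℝ, v ^ (σ - 1) * (2 * exp (-(2 * k * v))) =
        2 * (v ^ (σ - 1) * exp (-(2 * k * v))) := fun v => by ring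
      simp_rw [this]
      rw [integral_const_mul, hval, one_div, inv_rpow hk.le, mul_rpow (by norm_num) (by positivity),
        rpow_neg (by positivity), rpow_sub_one (by norm_num)]
      field_simp
    · filter_upwards [ae_restrict_mem measurableSet_Ioi] with v hv
      have : (0 : ℝ) < v := hv
      positivity
  calc ∫⁻ v in Ioi (0 : ℝ), ENNReal.ofReal (v ^ (σ - 1) * (cothR v - 1))
      = ∫⁻ v in Ioi (0 : ℝ), ∑' k : ℕ+,
          ENNReal.ofReal (v ^ (σ - 1) * (2 * exp (-(2 * k * v)))) := by
        refine setLIntegral_congr_fun measurableSet_Ioi fun v hv => ?_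
        have hv' : (0 : ℝ) < v := hv
        have hs := (hasSum_cothR_sub_one hv').mul_left (v ^ (σ - 1))
        rw [← hs.tsum_eq, ENNReal.ofReal_tsum_of_nonneg (fun k => by positivity) hs.summable]
    _ = ∑' k : ℕ+, ENNReal.ofReal (Gamma σ / 2 ^ (σ - 1) * (k : ℝ) ^ (-σ)) := by
        rw [lintegral_tsum fun k => by fun_prop]
        exact tsum_congr hterm
    _ = ENNReal.ofReal (Gamma σ / 2 ^ (σ - 1) * zetaR σ) := by
        have hG := Gamma_pos_of_pos hσ0
        rw [← ENNReal.ofReal_tsum_of_nonneg (fun k => by positivity)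
          ((summable_pnat_rpow_neg hσ).mul_left _), tsum_mul_left, zetaR]

/-- Strict Jensen inequality for the power function. -/
lemma integral_rpow_lt_of_not_ae_const {α : Type*} [MeasurableSpace α] {ν : Measure α}
    [IsFiniteMeasure ν] {p : ℝ} (hp : 1 < p) {h : α → ℝ} (hh : AEStronglyMeasurable h ν)
    (h0 : ∀ x, 0 ≤ h x) (hi : Integrable (fun x => h x ^ p) ν)
    (hc : ∀ c : ℝ, ¬ h =ᵐ[ν] fun _ => c) :
    (∫ x, h x ∂ν) ^ p < ν.real univ ^ (p - 1) * ∫ x, h x ^ p ∂ν := by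
  have hp0 : 0 < p := by linarith
  have hLp : MemLp h (ENNReal.ofReal p) ν := by
    rw [← integrable_norm_rpow_iff hh (by simpa using hp0) (by simp)]
    refine hi.congr (.of_forall fun x => ?_)
    simp [ENNReal.toReal_ofReal hp0.le, abs_of_nonneg (h0 x)]
  have hint : Integrable h ν := hLp.integrable (by simpa using hp.le)
  have hν : 0 < ν.real univ := by
    refine (measureReal_nonneg).lt_of_ne' fun h => hc 0 ?_
    have : ν = 0 := by simpa [Measure.real, ENNReal.toReal_eq_zero_iff] using h
    simp [this, Filter.EventuallyEq]
  rcases (strictConvexOn_rpow hp).ae_eq_const_or_map_average_lt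
    (f := h) (μ := ν) (continuousOn_id.rpow_const fun _ _ => Or.inr hp0.le) isClosed_Ici
    (.of_forall h0) hint hi with h1 | h1
  · exact absurd h1 (hc _)
  · rw [average_eq, average_eq, smul_eq_mul, smul_eq_mul,
      mul_rpow (by positivity) (integral_nonneg h0), inv_rpow hν.le] at h1
    have hpow : ν.real univ ^ p = ν.real univ ^ (p - 1) * ν.real univ := by
      rw [← rpow_add_one hν.ne', sub_add_cancel]
    have h2 := mul_lt_mul_of_pos_left h1 (rpow_pos_of_pos hν p)
    rw [mul_inv_cancel_left₀ (rpow_pos_of_pos hν p).ne'] at h2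
    refine h2.trans_eq ?_
    rw [hpow]
    field_simp

/-- A nonzero function which is `p`-integrable for `dx / x` has no constant dilation. -/
lemma not_ae_const_of_integrableOn_rpow_div {p : ℝ} {g : ℝ → ℝ}
    (hA : IntegrableOn (fun x => g x ^ p / x) (Ioi 0))
    (hpos : 0 < ∫ x in Ioi (0 : ℝ), g x ^ p / x) {y : ℝ} (hy : 0 < y) (c : ℝ) :
    ¬ (fun v => g (y * v)) =ᵐ[volume.restrict (Ioi 0)] fun _ => c := by
  intro hc
  have h1 : IntegrableOn (fun v => g (y * v) ^ p / (y * v)) (Ioi 0) := by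
    have := (integrableOn_Ioi_comp_mul_left_iff (fun x => g x ^ p / x) 0 hy).2
    simp only [mul_zero] at this
    exact this hA
  have h2 : (fun v => g (y * v) ^ p / (y * v)) =ᵐ[volume.restrict (Ioi 0)]
      fun v => c ^ p / y * v⁻¹ := by
    filter_upwards [hc] with v hv
    rw [hv, div_mul_eq_div_div, div_eq_mul_inv (c ^ p / y)]
  have h3 : c ^ p / y = 0 := by
    by_contra hne
    refine not_integrableOn_Ioi_inv (a := 0) ?_
    have h4 := (h1.congr h2).const_mul (c ^ p / y)⁻¹
    refine h4.congr (.of_forall fun v => ?_)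
    exact inv_mul_cancel_left₀ hne _
  have h5 := integral_comp_mul_left_Ioi (fun x => g x ^ p / x) 0 hy
  rw [integral_congr_ae h2, h3, mul_zero] at h5
  simp only [zero_mul, integral_zero, smul_eq_mul] at h5
  exact (mul_pos (inv_pos.2 hy) hpos).ne h5

/-- Strict Minkowski inequality for averages of dilations in `L^p (dx / x)`. -/
theorem integral_average_dilation_rpow_lt {p : ℝ} (hp : 1 < p) {ν : Measure ℝ}
    [IsFiniteMeasure ν] (hν : ν ≪ volume.restrict (Ioi 0)) (hν' : volume.restrict (Ioi 0) ≪ ν)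
    {g : ℝ → ℝ} (hg : Measurable g) (hg0 : ∀ x, 0 ≤ g x)
    (hA : IntegrableOn (fun x => g x ^ p / x) (Ioi 0))
    (hpos : 0 < ∫ x in Ioi (0 : ℝ), g x ^ p / x) :
    ∫ y in Ioi (0 : ℝ), (∫ v, g (y * v) ∂ν) ^ p / y <
      ν.real univ ^ p * ∫ x in Ioi (0 : ℝ), g x ^ p / x := by
  set μ := volume.restrict (Ioi (0 : ℝ)) with hμ
  set A := ∫ x, g x ^ p / x ∂μ with hAdef
  have hμpos : ∀ᵐ y ∂μ, (0 : ℝ) < y := ae_restrict_mem measurableSet_Ioi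
  have hνpos : ∀ᵐ v ∂ν, (0 : ℝ) < v := hν.ae_le hμpos
  have hμ0 : μ ≠ 0 := by simp [hμ]
  have hν0 : 0 < ν.real univ := by
    refine measureReal_nonneg.lt_of_ne' fun h => hμ0 ?_
    have : ν = 0 := by simpa [Measure.real, ENNReal.toReal_eq_zero_iff] using h
    rwa [this, Measure.absolutelyContinuous_zero_iff] at hν'
  have hpow : ν.real univ ^ p = ν.real univ ^ (p - 1) * ν.real univ := by
    rw [← rpow_add_one hν0.ne', sub_add_cancel]
  have hdil : ∀ v : ℝ, 0 < v → Integrable (fun y => g (y * v) ^ p / y) μ ∧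
      ∫ y, g (y * v) ^ p / y ∂μ = A := by
    intro v hv
    have hfun : (fun y => g (y * v) ^ p / y) = fun y => v * (g (v * y) ^ p / (v * y)) := by
      ext y
      rw [mul_comm y v]
      field_simp
    have h1 := (integrableOn_Ioi_comp_mul_left_iff (fun x => g x ^ p / x) 0 hv).2
    have h2 := integral_comp_mul_left_Ioi (fun x => g x ^ p / x) 0 hv
    simp only [mul_zero] at h1 h2
    rw [hfun]
    refine ⟨(h1 hA).const_mul v, ?_⟩
    rw [integral_const_mul, h2, smul_eq_mul, mul_inv_cancel_left₀ hv.ne']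
  have hmeas : Measurable fun z : ℝ × ℝ => g (z.1 * z.2) ^ p / z.1 := by fun_prop
  have hprod : Integrable (fun z : ℝ × ℝ => g (z.1 * z.2) ^ p / z.1) (μ.prod ν) := by
    rw [integrable_prod_iff' hmeas.aestronglyMeasurable]
    refine ⟨hνpos.mono fun v hv => (hdil v hv).1, ?_⟩
    refine (integrable_const A).congr ?_
    filter_upwards [hνpos] with v hv
    rw [← (hdil v hv).2]
    refine integral_congr_ae ?_
    filter_upwards [hμpos] with y hy
    rw [norm_of_nonneg (div_nonneg (rpow_nonneg (hg0 _) _) hy.le)]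
  have htotal : ∫ y, ∫ v, g (y * v) ^ p / y ∂ν ∂μ = ν.real univ * A := by
    rw [integral_integral_swap hprod]
    rw [integral_congr_ae (hνpos.mono fun v hv => (hdil v hv).2), integral_const,
      smul_eq_mul]
  have hH := hprod.integral_prod_left.const_mul (ν.real univ ^ (p - 1))
  have hlt : ∀ᵐ y ∂μ, (∫ v, g (y * v) ∂ν) ^ p / y <
      ν.real univ ^ (p - 1) * ∫ v, g (y * v) ^ p / y ∂ν := by
    filter_upwards [hμpos, hprod.prod_right_ae] with y hy hi
    have hi' : Integrable (fun v => g (y * v) ^ p) ν :=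
      (hi.mul_const y).congr (.of_forall fun v => div_mul_cancel₀ _ hy.ne')
    have h1 := integral_rpow_lt_of_not_ae_const hp (h := fun v => g (y * v))
      (hg.comp (measurable_const_mul y)).aestronglyMeasurable (fun _ => hg0 _) hi'
      fun c hc => not_ae_const_of_integrableOn_rpow_div hA hpos hy c (hν'.ae_le hc)
    rw [integral_div, ← mul_div_assoc]
    gcongr
  have hL0 : ∀ᵐ y ∂μ, 0 ≤ (∫ v, g (y * v) ∂ν) ^ p / y := by
    filter_upwards [hμpos] with y hy
    exact div_nonneg (rpow_nonneg (integral_nonneg fun _ => hg0 _) _) hy.le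
  have hLmeas : AEStronglyMeasurable (fun y => (∫ v, g (y * v) ∂ν) ^ p / y) μ := by
    have h1 : Measurable fun y => ∫ v, g (y * v) ∂ν :=
      (StronglyMeasurable.integral_prod_right (f := fun y v => g (y * v)) (ν := ν)
        (hg.comp measurable_mul).stronglyMeasurable).measurable
    exact Measurable.aestronglyMeasurable (by fun_prop)
  have hL : Integrable (fun y => (∫ v, g (y * v) ∂ν) ^ p / y) μ := by
    refine hH.mono' hLmeas ?_
    filter_upwards [hlt, hL0] with y h1 h2
    rw [norm_of_nonneg h2]
    exact h1.le
  have hval : ∫ y, ν.real univ ^ (p - 1) * ∫ v, g (y * v) ^ p / y ∂ν ∂μ =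
      ν.real univ ^ p * A := by
    rw [integral_const_mul, htotal, hpow, mul_assoc]
  rw [← hval]
  refine (integral_mono_ae hL hH (hlt.mono fun _ h => h.le)).lt_of_ne fun heq => hμ0 ?_
  have h1 := (integral_eq_iff_of_ae_le hL hH (hlt.mono fun _ h => h.le)).1 heq
  rw [← ae_eq_bot, ← Filter.eventually_false_iff_eq_bot]
  filter_upwards [hlt, h1] with y h2 h3 using h2.ne h3

theorem stmt_12 (p q σ : ℝ) (hp : 1 < p) (hpq : 1 / p + 1 / q = 1) (hσ : 1 < σ)
    (f : ℝ → ℝ) (hf : Measurable f) (hf0 : ∀ x, 0 ≤ f x)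
    (hfi : IntegrableOn (fun x => x ^ (p * (1 - σ) - 1) * f x ^ p) (Ioi 0) volume)
    (hfpos : 0 < ∫ x in Ioi (0:ℝ), x ^ (p * (1 - σ) - 1) * f x ^ p) :
    (∫ y in Ioi (0:ℝ), y ^ (-p * σ - 1) *
        (∫ x in Ioi (0:ℝ), (cothR (x / y) - 1) * f x) ^ p) ^ (1 / p) <
      (Real.Gamma σ / 2 ^ (σ - 1)) * zetaR σ *
        (∫ x in Ioi (0:ℝ), x ^ (p * (1 - σ) - 1) * f x ^ p) ^ (1 / p) := by
  have hp0 : 0 < p := by linarith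
  have hK : 0 < Gamma σ / 2 ^ (σ - 1) * zetaR σ := by
    have := Gamma_pos_of_pos (by linarith : 0 < σ)
    have := zetaR_pos hσ
    positivity
  set K := Gamma σ / 2 ^ (σ - 1) * zetaR σ
  set w : ℝ → ℝ := fun v => v ^ (σ - 1) * (cothR v - 1) with hw
  have hwpos : ∀ v : ℝ, 0 < v → 0 < w v := fun v hv =>
    mul_pos (rpow_pos_of_pos hv _) (cothR_sub_one_pos hv)
  have hwm : Measurable w := by unfold w cothR; fun_prop
  have hwm' : Measurable fun v => ENNReal.ofReal (w v) := by fun_prop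
  set ν := (volume.restrict (Ioi (0 : ℝ))).withDensity fun v => ENNReal.ofReal (w v)
  have hνuniv : ν univ = ENNReal.ofReal K := by
    rw [withDensity_apply _ .univ, Measure.restrict_univ, lintegral_cothR_sub_one_mul_rpow hσ]
  have : IsFiniteMeasure ν := ⟨by simp [hνuniv]⟩
  have hνK : ν.real univ = K := by rw [Measure.real, hνuniv, ENNReal.toReal_ofReal hK.le]
  have hν : ν ≪ volume.restrict (Ioi 0) := withDensity_absolutelyContinuous _ _
  have hν' : volume.restrict (Ioi 0) ≪ ν := by
    refine withDensity_absolutelyContinuous' hwm'.aemeasurable ?_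
    filter_upwards [ae_restrict_mem measurableSet_Ioi] with v hv
    simpa using hwpos v hv
  set g : ℝ → ℝ := fun x => |x| ^ (1 - σ) * f x with hgdef
  have hg0 : ∀ x, 0 ≤ g x := fun x => mul_nonneg (rpow_nonneg (abs_nonneg _) _) (hf0 x)
  have hgm : Measurable g := by fun_prop
  have hgp : EqOn (fun x => x ^ (p * (1 - σ) - 1) * f x ^ p) (fun x => g x ^ p / x) (Ioi 0) := by
    intro x hx
    have hx' : (0 : ℝ) < x := hx
    simp only [hgdef, abs_of_pos hx']
    rw [mul_rpow (by positivity) (hf0 x), ← rpow_mul hx'.le, rpow_sub_one hx'.ne',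
      mul_comm (1 - σ) p]
    ring
  have hinner : ∀ y : ℝ, 0 < y → ∫ x in Ioi (0 : ℝ), (cothR (x / y) - 1) * f x =
      y ^ σ * ∫ v, g (y * v) ∂ν := by
    intro y hy
    have h1 := integral_comp_mul_left_Ioi (fun x => (cothR (x / y) - 1) * f x) 0 hy
    rw [mul_zero, smul_eq_mul, eq_inv_mul_iff_mul_eq₀ hy.ne'] at h1
    rw [← h1, integral_withDensity_eq_integral_toReal_smul hwm' (by simp),
      ← integral_const_mul, ← integral_const_mul]
    refine setIntegral_congr_fun measurableSet_Ioi fun v hv => ?_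
    have hv' : (0 : ℝ) < v := hv
    simp only [ENNReal.toReal_ofReal (hwpos v hv').le]
    simp only [smul_eq_mul, hw, hgdef,
      abs_of_pos (mul_pos hy hv'), mul_div_cancel_left₀ v hy.ne']
    rw [mul_rpow hy.le hv'.le]
    have e1 : v ^ (σ - 1) * v ^ (1 - σ) = 1 := by rw [← rpow_add hv']; simp
    have e2 : y ^ σ * y ^ (1 - σ) = y := by rw [← rpow_add hy]; simp
    linear_combination (-(cothR v - 1) * f (y * v)) * (y ^ σ * y ^ (1 - σ) * e1 + e2)
  have houter : EqOn (fun y => y ^ (-p * σ - 1) *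
      (∫ x in Ioi (0:ℝ), (cothR (x / y) - 1) * f x) ^ p)
      (fun y => (∫ v, g (y * v) ∂ν) ^ p / y) (Ioi 0) := by
    intro y hy
    have hy' : (0 : ℝ) < y := hy
    have e : y ^ (-p * σ) * y ^ (σ * p) = 1 := by
      rw [← rpow_add hy', neg_mul, mul_comm σ p, neg_add_cancel, rpow_zero]
    simp only [hinner y hy']
    rw [mul_rpow (by positivity) (integral_nonneg fun _ => hg0 _), ← rpow_mul hy'.le,
      rpow_sub_one hy'.ne']
    linear_combination ((∫ v, g (y * v) ∂ν) ^ p / y) * e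
  rw [setIntegral_congr_fun measurableSet_Ioi houter]
  rw [setIntegral_congr_fun measurableSet_Ioi hgp] at hfpos ⊢
  rw [integrableOn_congr_fun hgp measurableSet_Ioi] at hfi
  have key := integral_average_dilation_rpow_lt hp hν hν' hgm hg0 hfi hfpos
  rw [hνK] at key
  have hL : 0 ≤ ∫ y in Ioi (0 : ℝ), (∫ v, g (y * v) ∂ν) ^ p / y :=
    setIntegral_nonneg measurableSet_Ioi fun y hy =>
      div_nonneg (rpow_nonneg (integral_nonneg fun _ => hg0 _) _) (le_of_lt hy)
  refine (rpow_lt_rpow hL key (by positivity)).trans_eq ?_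
  rw [mul_rpow (by positivity) hfpos.le, ← rpow_mul hK.le, mul_one_div_cancel hp0.ne', rpow_one]
end

section
/- Let m, n ∈ ℕ, α, β > 0, σ > 1, p > 1, 1/p + 1/q = 1. For measurable f : ℝ₊^m → [0,∞) and g : ℝ₊^n → [0,∞) with 0 < ∫_{ℝ₊^m} ‖x‖_α^{p(m−σ)−m} f(x)^p dx < ∞ and 0 < ∫_{ℝ₊^n} ‖y‖_β^{q(n+σ)−n} g(y)^q dy < ∞, we have ∫_{ℝ₊^n}∫_{ℝ₊^m} (coth(‖x‖_α/‖y‖_β) − 1) f(x) g(y) dx dy < K(σ) · (∫_{ℝ₊^m} ‖x‖_α^{p(m−σ)−m} f(x)^p dx)^{1/p} (∫_{ℝ₊^n} ‖y‖_β^{q(n+σ)−n} g(y)^q dy)^{1/q}, where K(σ) = [Γ(1/β)^n/(β^{n−1}Γ(n/β))]^{1/p} · [Γ(1/α)^m/(α^{m−1}Γ(m/α))]^{1/q} · (Γ(σ)/2^{σ−1}) ζ(σ). -/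
open MeasureTheory Real Set

noncomputable def pnorm {s : ℕ} (γ : ℝ) (x : Fin s → ℝ) : ℝ := (∑ i, |x i| ^ γ) ^ (1 / γ)

/-- The open positive orthant. -/
abbrev posOrthant (s : ℕ) : Set (Fin s → ℝ) := {x | ∀ i, 0 < x i}

lemma posOrthant_eq_pi (s : ℕ) : posOrthant s = univ.pi fun _ => Ioi (0 : ℝ) := by
  ext x
  simp [posOrthant]

lemma measurableSet_posOrthant (s : ℕ) : MeasurableSet (posOrthant s) := by
  rw [posOrthant_eq_pi]
  exact MeasurableSet.univ_pi fun _ => measurableSet_Ioi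

lemma measurable_pnorm {s : ℕ} (γ : ℝ) : Measurable (pnorm γ : (Fin s → ℝ) → ℝ) := by
  unfold pnorm
  fun_prop

lemma pnorm_pos {s : ℕ} (hs : 0 < s) (γ : ℝ) {x : Fin s → ℝ} (hx : x ∈ posOrthant s) :
    0 < pnorm γ x := by
  have : Nonempty (Fin s) := ⟨⟨0, hs⟩⟩
  exact rpow_pos_of_pos
    (Finset.sum_pos (fun i _ => rpow_pos_of_pos (abs_pos.2 (hx i).ne') _) Finset.univ_nonempty) _

lemma pnorm_smul {s : ℕ} {γ : ℝ} (hγ : 0 < γ) {r : ℝ} (hr : 0 < r) (x : Fin s → ℝ) :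
    pnorm γ (r • x) = r * pnorm γ x := by
  unfold pnorm
  have h (i : Fin s) : |(r • x) i| ^ γ = r ^ γ * |x i| ^ γ := by
    rw [Pi.smul_apply, smul_eq_mul, abs_mul, mul_rpow (abs_nonneg _) (abs_nonneg _),
      abs_of_pos hr]
  simp_rw [h, ← Finset.mul_sum]
  rw [mul_rpow (by positivity) (Finset.sum_nonneg fun i _ => by positivity), ← rpow_mul hr.le,
    mul_one_div_cancel hγ.ne', rpow_one]

lemma pnorm_rpow {s : ℕ} {γ : ℝ} (hγ : 0 < γ) (x : Fin s → ℝ) :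
    pnorm γ x ^ γ = ∑ i, |x i| ^ γ := by
  unfold pnorm
  rw [← rpow_mul (Finset.sum_nonneg fun i _ => by positivity), one_div_mul_cancel hγ.ne', rpow_one]

lemma abs_le_pnorm {s : ℕ} {γ : ℝ} (hγ : 0 < γ) (x : Fin s → ℝ) (i : Fin s) :
    |x i| ≤ pnorm γ x := by
  have h0 : 0 ≤ pnorm γ x := rpow_nonneg (Finset.sum_nonneg fun i _ => by positivity) _
  rw [← rpow_le_rpow_iff (abs_nonneg _) h0 hγ, pnorm_rpow hγ]
  exact Finset.single_le_sum (f := fun i => |x i| ^ γ) (fun i _ => by positivity)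
    (Finset.mem_univ i)

/-- The distribution of `pnorm γ` under Lebesgue measure on the positive orthant. -/
noncomputable def radialMeasure (s : ℕ) (γ : ℝ) : Measure ℝ :=
  (volume.restrict (posOrthant s)).map (pnorm γ)

lemma radialMeasure_Iic (s : ℕ) (γ r : ℝ) :
    radialMeasure s γ (Iic r) = volume (posOrthant s ∩ {x | pnorm γ x ≤ r}) := by
  rw [radialMeasure, Measure.map_apply (measurable_pnorm γ) measurableSet_Iic,
    Measure.restrict_apply (measurable_pnorm γ measurableSet_Iic), inter_comm]
  rfl

lemma radialMeasure_Iic_one_ne_top (s : ℕ) {γ : ℝ} (hγ : 0 < γ) :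
    radialMeasure s γ (Iic 1) ≠ ⊤ := by
  rw [radialMeasure_Iic]
  refine ((measure_mono ?_).trans_lt (isCompact_closedBall (0 : Fin s → ℝ) 1).measure_lt_top).ne
  rintro x ⟨-, hx⟩
  rw [mem_closedBall_zero_iff, pi_norm_le_iff_of_nonneg zero_le_one]
  exact fun i => (abs_le_pnorm hγ x i).trans hx

lemma radialMeasure_Iic_of_pos (s : ℕ) {γ : ℝ} (hγ : 0 < γ) {r : ℝ} (hr : 0 < r) :
    radialMeasure s γ (Iic r) = ENNReal.ofReal (r ^ s) * radialMeasure s γ (Iic 1) := by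
  rw [radialMeasure_Iic, radialMeasure_Iic]
  have h := Measure.addHaar_smul (volume : Measure (Fin s → ℝ)) r
    (posOrthant s ∩ {x | pnorm γ x ≤ 1})
  rw [Module.finrank_fin_fun, abs_of_pos (pow_pos hr s)] at h
  rw [← h]
  congr 1
  ext x
  rw [mem_smul_set_iff_inv_smul_mem₀ hr.ne']
  simp only [mem_inter_iff, mem_ofPred_eq, pnorm_smul hγ (inv_pos.2 hr), Pi.smul_apply,
    smul_eq_mul, inv_mul_le_iff₀ hr, mul_one, mul_pos_iff_of_pos_left (inv_pos.2 hr)]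

lemma radialMeasure_Iic_of_nonpos {s : ℕ} (hs : 0 < s) (γ : ℝ) {r : ℝ} (hr : r ≤ 0) :
    radialMeasure s γ (Iic r) = 0 := by
  rw [radialMeasure_Iic]
  convert measure_empty (μ := (volume : Measure (Fin s → ℝ)))
  ext x
  simp only [mem_inter_iff, mem_ofPred_eq, mem_empty_iff_false, iff_false, not_and, not_le]
  exact fun hx => hr.trans_lt (pnorm_pos hs γ hx)

lemma eq_of_Iic_of_ne_top {μ ν : Measure ℝ} (hμ : ∀ r, μ (Iic r) ≠ ⊤)
    (h : ∀ r, μ (Iic r) = ν (Iic r)) : μ = ν := by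
  have : IsLocallyFiniteMeasure μ :=
    ⟨fun x => ⟨Iic (x + 1), Iic_mem_nhds (lt_add_one x), (hμ _).lt_top⟩⟩
  refine Measure.ext_of_Ioc μ ν fun a b hab => ?_
  have hs : Iic a ⊆ Iic b := Iic_subset_Iic.2 hab.le
  rw [← Iic_sdiff_Iic, measure_sdiff hs measurableSet_Iic.nullMeasurableSet (hμ a),
    measure_sdiff hs measurableSet_Iic.nullMeasurableSet (h a ▸ hμ a), h, h]

lemma lintegral_pow_Ioc {s : ℕ} (hs : 0 < s) {r : ℝ} (hr : 0 < r) :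
    ∫⁻ t in Ioc 0 r, ENNReal.ofReal (t ^ (s - 1)) = ENNReal.ofReal (r ^ s / s) := by
  rw [← ofReal_integral_eq_lintegral_ofReal, ← intervalIntegral.integral_of_le hr.le,
    integral_pow]
  · have : s - 1 + 1 = s := by omega
    rw [this, zero_pow hs.ne', sub_zero]
    congr 2
    exact_mod_cast this
  · exact ((continuous_pow _).integrableOn_Icc).mono_set Ioc_subset_Icc_self
  · filter_upwards [ae_restrict_mem measurableSet_Ioc] with t ht
    exact pow_nonneg ht.1.le _

lemma radialMeasure_eq {s : ℕ} (hs : 0 < s) {γ : ℝ} (hγ : 0 < γ) :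
    radialMeasure s γ = (s * radialMeasure s γ (Iic 1)) •
      (volume.restrict (Ioi 0)).withDensity fun t => ENNReal.ofReal (t ^ (s - 1)) := by
  refine eq_of_Iic_of_ne_top (fun r => ?_) fun r => ?_
  · rcases le_or_gt r 0 with hr | hr
    · simp [radialMeasure_Iic_of_nonpos hs γ hr]
    · rw [radialMeasure_Iic_of_pos s hγ hr]
      exact ENNReal.mul_ne_top ENNReal.ofReal_ne_top (radialMeasure_Iic_one_ne_top s hγ)
  · rw [Measure.smul_apply, withDensity_apply _ measurableSet_Iic,
      Measure.restrict_restrict measurableSet_Iic, Iic_inter_Ioi]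
    rcases le_or_gt r 0 with hr | hr
    · simp [radialMeasure_Iic_of_nonpos hs γ hr, Ioc_eq_empty_of_le hr]
    · have h : ENNReal.ofReal (r ^ s) = s * ENNReal.ofReal (r ^ s / s) := by
        rw [← ENNReal.ofReal_natCast, ← ENNReal.ofReal_mul (by positivity),
          mul_div_cancel₀ _ (by positivity)]
      rw [radialMeasure_Iic_of_pos s hγ hr, lintegral_pow_Ioc hs hr, smul_eq_mul, h]
      ring

lemma lintegral_exp_neg_pnorm_rpow (s : ℕ) {γ : ℝ} (hγ : 0 < γ) :
    ∫⁻ x in posOrthant s, ENNReal.ofReal (exp (-pnorm γ x ^ γ)) =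
      ENNReal.ofReal (Gamma (1 / γ + 1) ^ s) := by
  have hvol : (volume : Measure (Fin s → ℝ)).restrict (posOrthant s) =
      Measure.pi fun _ => (volume : Measure ℝ).restrict (Ioi 0) := by
    rw [posOrthant_eq_pi, volume_pi, Measure.restrict_pi_pi]
  have h1 : ∫⁻ x in posOrthant s, ENNReal.ofReal (exp (-pnorm γ x ^ γ)) =
      ∫⁻ x in posOrthant s, ENNReal.ofReal (∏ i, exp (-x i ^ γ)) := by
    refine setLIntegral_congr_fun (measurableSet_posOrthant s) fun x hx => ?_
    simp only [pnorm_rpow hγ, ← exp_sum, Finset.sum_neg_distrib]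
    congr 3
    exact Finset.sum_congr rfl fun i _ => by rw [abs_of_pos (hx i)]
  have hint : IntegrableOn (fun t : ℝ => exp (-t ^ γ)) (Ioi 0) := by
    refine Integrable.of_integral_ne_zero ?_
    rw [integral_exp_neg_rpow hγ]
    exact (Gamma_pos_of_pos (by positivity)).ne'
  rw [h1, hvol, ← ofReal_integral_eq_lintegral_ofReal, integral_fintype_prod_eq_pow
    (fun t : ℝ => exp (-t ^ γ)), integral_exp_neg_rpow hγ, Fintype.card_fin]
  · exact Integrable.fintype_prod fun _ => hint
  · exact Filter.Eventually.of_forall fun x => Finset.prod_nonneg fun i _ => (exp_pos _).le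

lemma lintegral_pnorm_aux {s : ℕ} (hs : 0 < s) {γ : ℝ} (hγ : 0 < γ) {φ : ℝ → ENNReal}
    (hφ : Measurable φ) :
    ∫⁻ x in posOrthant s, φ (pnorm γ x) = s * radialMeasure s γ (Iic 1) *
      ∫⁻ t in Ioi 0, ENNReal.ofReal (t ^ (s - 1)) * φ t := by
  rw [← lintegral_map hφ (measurable_pnorm γ)]
  change ∫⁻ t, φ t ∂(radialMeasure s γ) = _
  rw [radialMeasure_eq hs hγ, lintegral_smul_measure,
    lintegral_withDensity_eq_lintegral_mul _ (by fun_prop) hφ, smul_eq_mul,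
    ← radialMeasure_eq hs hγ]
  rfl

/-- The ratio between Lebesgue measure on the positive orthant and its radial part. -/
noncomputable def sphereConst (s : ℕ) (γ : ℝ) : ℝ :=
  Gamma (1 / γ) ^ s / (γ ^ (s - 1) * Gamma (s / γ))

lemma sphereConst_pos {s : ℕ} (hs : 0 < s) {γ : ℝ} (hγ : 0 < γ) : 0 < sphereConst s γ := by
  have h1 : 0 < Gamma (1 / γ) := Gamma_pos_of_pos (by positivity)
  have h2 : 0 < Gamma (s / γ) := Gamma_pos_of_pos (by positivity)
  unfold sphereConst
  positivity

lemma radialMeasure_Iic_one {s : ℕ} (hs : 0 < s) {γ : ℝ} (hγ : 0 < γ) :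
    s * radialMeasure s γ (Iic 1) = ENNReal.ofReal (sphereConst s γ) := by
  have h := lintegral_pnorm_aux hs hγ (φ := fun t => ENNReal.ofReal (exp (-t ^ γ))) (by fun_prop)
  have hG : 0 < Gamma (s / γ) := Gamma_pos_of_pos (by positivity)
  have hval : ∫ t in Ioi (0 : ℝ), t ^ ((s : ℝ) - 1) * exp (-t ^ γ) = 1 / γ * Gamma (s / γ) := by
    rw [integral_rpow_mul_exp_neg_rpow hγ (by simpa using hs), sub_add_cancel]
  have hrad : ∫⁻ t in Ioi (0 : ℝ), ENNReal.ofReal (t ^ (s - 1)) * ENNReal.ofReal (exp (-t ^ γ)) =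
      ENNReal.ofReal (1 / γ * Gamma (s / γ)) := by
    rw [← hval, ofReal_integral_eq_lintegral_ofReal]
    · refine setLIntegral_congr_fun measurableSet_Ioi fun t ht => ?_
      have ht' : (0 : ℝ) < t := ht
      rw [← ENNReal.ofReal_mul (by positivity), ← rpow_natCast, Nat.cast_pred hs]
    · refine Integrable.of_integral_ne_zero ?_
      rw [hval]
      positivity
    · filter_upwards [ae_restrict_mem measurableSet_Ioi] with t ht
      have ht' : (0 : ℝ) < t := ht
      exact mul_nonneg (rpow_nonneg ht'.le _) (exp_pos _).le
  rw [lintegral_exp_neg_pnorm_rpow s hγ, hrad] at h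
  have hpos : 0 < 1 / γ * Gamma (s / γ) := by positivity
  rw [← ENNReal.mul_left_inj (c := ENNReal.ofReal (1 / γ * Gamma (s / γ)))
    (by simpa using hpos) ENNReal.ofReal_ne_top, ← h,
    ← ENNReal.ofReal_mul (sphereConst_pos hs hγ).le]
  congr 1
  obtain ⟨k, rfl⟩ : ∃ k, s = k + 1 := ⟨s - 1, by omega⟩
  rw [Gamma_add_one (by positivity), sphereConst, mul_pow, Nat.add_sub_cancel, one_div,
    inv_pow, pow_succ γ]
  field_simp

/-- Integration of a radial function over the positive orthant. -/
lemma lintegral_pnorm {s : ℕ} (hs : 0 < s) {γ : ℝ} (hγ : 0 < γ) {φ : ℝ → ENNReal}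
    (hφ : Measurable φ) :
    ∫⁻ x in posOrthant s, φ (pnorm γ x) = ENNReal.ofReal (sphereConst s γ) *
      ∫⁻ t in Ioi 0, ENNReal.ofReal (t ^ (s - 1)) * φ t := by
  rw [lintegral_pnorm_aux hs hγ hφ, radialMeasure_Iic_one hs hγ]

lemma cothR_sub_one {t : ℝ} (ht : 0 < t) :
    HasSum (fun k : ℕ+ => 2 * exp (-(2 * k * t))) (cothR t - 1) := by
  have hr : exp (-(2 * t)) < 1 := Real.exp_lt_one_iff.2 (by linarith)
  have h := ((hasSum_geometric_of_lt_one (exp_pos (-(2 * t))).le hr).mul_left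
    (2 * exp (-(2 * t))))
  rw [← Equiv.pnatEquivNat.hasSum_iff] at h
  have hterm : (fun k : ℕ+ => 2 * exp (-(2 * k * t))) =
      (fun i : ℕ => 2 * exp (-(2 * t)) * exp (-(2 * t)) ^ i) ∘ Equiv.pnatEquivNat := by
    ext k
    simp only [Function.comp_apply, Equiv.pnatEquivNat_apply, mul_assoc, ← exp_nat_mul, ← exp_add]
    congr 2
    rw [PNat.natPred, Nat.cast_pred k.pos]
    ring
  have hval : cothR t - 1 = 2 * exp (-(2 * t)) * (1 - exp (-(2 * t)))⁻¹ := by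
    have h1 : exp (-(2 * t)) = (exp t)⁻¹ * (exp t)⁻¹ := by
      rw [← exp_neg, ← exp_add]
      ring_nf
    have h2 : 1 < exp t := one_lt_exp_iff.2 ht
    have h3 : exp t ^ 2 - 1 ≠ 0 := by nlinarith
    rw [cothR, h1, exp_neg]
    have h4 : exp t - (exp t)⁻¹ ≠ 0 := by
      have : (exp t)⁻¹ < 1 := inv_lt_one_of_one_lt₀ h2
      linarith
    have h5 : 1 - (exp t)⁻¹ * (exp t)⁻¹ ≠ 0 := by
      have : (exp t)⁻¹ < 1 := inv_lt_one_of_one_lt₀ h2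
      have : 0 < (exp t)⁻¹ := by positivity
      nlinarith
    field_simp
    ring
  rwa [hterm, hval]

lemma cothR_sub_one_pos_s14 {t : ℝ} (ht : 0 < t) : 0 < cothR t - 1 :=
  (mul_pos two_pos (exp_pos _)).trans_le
    (le_hasSum (cothR_sub_one ht) 1 fun _ _ => (mul_pos two_pos (exp_pos _)).le)

lemma measurable_cothR : Measurable cothR := by
  unfold cothR
  fun_prop

/-- The Mellin transform of `cothR - 1`. -/
noncomputable def cothMellin (σ : ℝ) : ℝ := Gamma σ / 2 ^ (σ - 1) * zetaR σ

lemma cothMellin_pos {σ : ℝ} (hσ : 1 < σ) : 0 < cothMellin σ := by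
  have h1 : 0 < Gamma σ := Gamma_pos_of_pos (by linarith)
  have h2 : 0 < zetaR σ := (summable_pnat_rpow_neg hσ).tsum_pos
    (fun k => rpow_nonneg (Nat.cast_nonneg _) _) 1 (by simp)
  unfold cothMellin
  positivity

lemma lintegral_cothR {σ : ℝ} (hσ : 1 < σ) :
    ∫⁻ t in Ioi 0, ENNReal.ofReal (t ^ (σ - 1) * (cothR t - 1)) =
      ENNReal.ofReal (cothMellin σ) := by
  have hG : 0 < Gamma σ := Gamma_pos_of_pos (by linarith)
  have hterm (k : ℕ+) : ∫⁻ t in Ioi 0, ENNReal.ofReal (t ^ (σ - 1) * (2 * exp (-(2 * k * t)))) =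
      ENNReal.ofReal (Gamma σ / 2 ^ (σ - 1) * (k : ℝ) ^ (-σ)) := by
    have hk : (0 : ℝ) < k := by exact_mod_cast k.pos
    have hval : ∫ t in Ioi (0 : ℝ), t ^ (σ - 1) * (2 * exp (-(2 * k * t))) =
        Gamma σ / 2 ^ (σ - 1) * (k : ℝ) ^ (-σ) := by
      have h (t : ℝ) : t ^ (σ - 1) * (2 * exp (-(2 * k * t))) =
        2 * (t ^ (σ - 1) * exp (-(2 * k * t))) := by ring
      simp_rw [h]
      rw [integral_const_mul, integral_rpow_mul_exp_neg_mul_Ioi (by linarith) (by positivity),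
        one_div, inv_rpow (by positivity), mul_rpow zero_le_two hk.le, rpow_neg hk.le,
        rpow_sub_one two_ne_zero]
      field_simp
    rw [← hval, ofReal_integral_eq_lintegral_ofReal]
    · refine Integrable.of_integral_ne_zero ?_
      rw [hval]
      positivity
    · filter_upwards [ae_restrict_mem measurableSet_Ioi] with t ht
      have ht' : (0 : ℝ) < t := ht
      exact mul_nonneg (rpow_nonneg ht'.le _) (by positivity)
  calc ∫⁻ t in Ioi 0, ENNReal.ofReal (t ^ (σ - 1) * (cothR t - 1))
      = ∫⁻ t in Ioi 0, ∑' k : ℕ+, ENNReal.ofReal (t ^ (σ - 1) * (2 * exp (-(2 * k * t)))) := by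
        refine setLIntegral_congr_fun measurableSet_Ioi fun t ht => ?_
        have ht' : (0 : ℝ) < t := ht
        have h := (cothR_sub_one ht').mul_left (t ^ (σ - 1))
        rw [← h.tsum_eq, ENNReal.ofReal_tsum_of_nonneg (fun k => by positivity) h.summable]
    _ = ∑' k : ℕ+, ENNReal.ofReal (Gamma σ / 2 ^ (σ - 1) * (k : ℝ) ^ (-σ)) := by
        rw [lintegral_tsum fun k => by fun_prop]
        exact tsum_congr hterm
    _ = ENNReal.ofReal (cothMellin σ) := by
        rw [← ENNReal.ofReal_tsum_of_nonneg (fun k => by positivity)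
          ((summable_pnat_rpow_neg hσ).mul_left _), tsum_mul_left, cothMellin, zetaR]

lemma lintegral_cothR_div {σ : ℝ} (hσ : 1 < σ) {s : ℕ} (hs : 0 < s) {v : ℝ} (hv : 0 < v) :
    ∫⁻ r in Ioi 0, ENNReal.ofReal (r ^ (s - 1)) *
      ENNReal.ofReal ((cothR (r / v) - 1) * r ^ (σ - s)) =
      ENNReal.ofReal (v ^ σ * cothMellin σ) := by
  have himg : (fun t => v * t) '' Ioi 0 = Ioi 0 := by
    rw [image_mul_left_Ioi hv, mul_zero]
  rw [← himg, lintegral_image_eq_lintegral_abs_deriv_mul (f' := fun _ => v) measurableSet_Ioi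
    (fun t _ => by simpa using ((hasDerivAt_id t).const_mul v).hasDerivWithinAt)
    (mul_right_injective₀ hv.ne').injOn,
    ENNReal.ofReal_mul (by positivity), ← lintegral_cothR hσ,
    ← lintegral_const_mul' _ _ ENNReal.ofReal_ne_top]
  refine setLIntegral_congr_fun measurableSet_Ioi fun t ht => ?_
  have ht' : (0 : ℝ) < t := ht
  rw [← ENNReal.ofReal_mul (by positivity), ← ENNReal.ofReal_mul (by positivity),
    ← ENNReal.ofReal_mul (by positivity), abs_of_pos hv, mul_div_cancel_left₀ _ hv.ne',
    ← rpow_natCast (v * t), Nat.cast_pred hs]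
  congr 1
  have h : v * ((v * t) ^ ((s : ℝ) - 1) * (v * t) ^ (σ - s)) = v ^ σ * t ^ (σ - 1) := by
    rw [← rpow_add (by positivity), mul_rpow hv.le ht'.le]
    have : (s : ℝ) - 1 + (σ - s) = σ - 1 := by ring
    rw [this, ← mul_assoc, rpow_sub_one hv.ne', mul_div_cancel₀ _ hv.ne']
  linear_combination (cothR t - 1) * h

lemma lintegral_cothR_div_left {σ : ℝ} (hσ : 1 < σ) {s : ℕ} (hs : 0 < s) {u : ℝ} (hu : 0 < u) :
    ∫⁻ r in Ioi 0, ENNReal.ofReal (r ^ (s - 1)) *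
      ENNReal.ofReal ((cothR (u / r) - 1) * r ^ (-σ - s)) =
      ENNReal.ofReal (u ^ (-σ) * cothMellin σ) := by
  have himg : (fun t => u / t) '' Ioi 0 = Ioi 0 := by
    ext r
    constructor
    · rintro ⟨t, ht, rfl⟩
      exact div_pos hu ht
    · exact fun hr => ⟨u / r, div_pos hu hr, div_div_cancel₀ hu.ne'⟩
  have hderiv : ∀ t ∈ Ioi (0 : ℝ),
      HasDerivWithinAt (fun t => u / t) (u * -(t ^ 2)⁻¹) (Ioi 0) t := by
    intro t ht
    simpa [div_eq_mul_inv] using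
      ((hasDerivAt_inv (ne_of_gt ht)).const_mul u).hasDerivWithinAt (s := Ioi 0)
  have hinj : InjOn (fun t => u / t) (Ioi 0) := by
    intro a ha b hb hab
    have ha' : a ≠ 0 := ne_of_gt ha
    have hb' : b ≠ 0 := ne_of_gt hb
    have : u / a = u / b := hab
    field_simp at this
    exact this.symm
  rw [← himg, lintegral_image_eq_lintegral_abs_deriv_mul measurableSet_Ioi hderiv hinj,
    ENNReal.ofReal_mul (by positivity), ← lintegral_cothR hσ,
    ← lintegral_const_mul' _ _ ENNReal.ofReal_ne_top]
  refine setLIntegral_congr_fun measurableSet_Ioi fun t ht => ?_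
  have ht' : (0 : ℝ) < t := ht
  rw [← ENNReal.ofReal_mul (by positivity), ← ENNReal.ofReal_mul (by positivity),
    ← ENNReal.ofReal_mul (by positivity), div_div_cancel₀ hu.ne', mul_neg, abs_neg,
    abs_of_pos (by positivity), ← rpow_natCast (u / t), Nat.cast_pred hs]
  congr 1
  have h : u * (t ^ 2)⁻¹ * ((u / t) ^ ((s : ℝ) - 1) * (u / t) ^ (-σ - s)) =
      u ^ (-σ) * t ^ (σ - 1) := by
    rw [← rpow_add (by positivity), div_rpow hu.le ht'.le]
    have : (s : ℝ) - 1 + (-σ - s) = -σ - 1 := by ring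
    rw [this, rpow_sub_one hu.ne', rpow_sub_one ht'.ne', rpow_sub_one ht'.ne', rpow_neg ht'.le]
    field_simp
  linear_combination (cothR t - 1) * h

lemma lintegral_cothR_pnorm_div {σ : ℝ} (hσ : 1 < σ) {s : ℕ} (hs : 0 < s) {γ : ℝ} (hγ : 0 < γ)
    {v : ℝ} (hv : 0 < v) :
    ∫⁻ x in posOrthant s, ENNReal.ofReal ((cothR (pnorm γ x / v) - 1) * pnorm γ x ^ (σ - s)) =
      ENNReal.ofReal (sphereConst s γ * (v ^ σ * cothMellin σ)) := by
  have hm := measurable_cothR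
  rw [ENNReal.ofReal_mul (sphereConst_pos hs hγ).le, ← lintegral_cothR_div hσ hs hv]
  exact lintegral_pnorm hs hγ
    (φ := fun r => ENNReal.ofReal ((cothR (r / v) - 1) * r ^ (σ - s))) (by fun_prop)

lemma lintegral_cothR_div_pnorm {σ : ℝ} (hσ : 1 < σ) {s : ℕ} (hs : 0 < s) {γ : ℝ} (hγ : 0 < γ)
    {u : ℝ} (hu : 0 < u) :
    ∫⁻ y in posOrthant s, ENNReal.ofReal ((cothR (u / pnorm γ y) - 1) * pnorm γ y ^ (-σ - s)) =
      ENNReal.ofReal (sphereConst s γ * (u ^ (-σ) * cothMellin σ)) := by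
  have hm := measurable_cothR
  rw [ENNReal.ofReal_mul (sphereConst_pos hs hγ).le, ← lintegral_cothR_div_left hσ hs hu]
  exact lintegral_pnorm hs hγ
    (φ := fun r => ENNReal.ofReal ((cothR (u / r) - 1) * r ^ (-σ - s))) (by fun_prop)

/-- The critical negative power of `pnorm` is not integrable on the positive orthant. -/
lemma not_integrableOn_pnorm_rpow {s : ℕ} (hs : 0 < s) {γ : ℝ} (hγ : 0 < γ) :
    ¬ IntegrableOn (fun x => pnorm γ x ^ (-s : ℝ)) (posOrthant s) := by
  intro h
  have hlt := h.lintegral_lt_top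
  rw [lintegral_pnorm hs hγ (φ := fun r => ENNReal.ofReal (r ^ (-s : ℝ))) (by fun_prop)] at hlt
  refine not_integrableOn_Ioi_inv (a := 0) ⟨by fun_prop, ?_⟩
  rw [hasFiniteIntegral_iff_ofReal]
  · refine ENNReal.lt_top_of_mul_ne_top_right (a := ENNReal.ofReal (sphereConst s γ)) ?_
      (by simpa using sphereConst_pos hs hγ)
    convert hlt.ne using 2
    refine setLIntegral_congr_fun measurableSet_Ioi fun t ht => ?_
    have ht' : (0 : ℝ) < t := ht
    rw [← ENNReal.ofReal_mul (by positivity), ← rpow_natCast, Nat.cast_pred hs,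
      ← rpow_add ht', ← rpow_neg_one]
    congr 2
    ring
  · filter_upwards [ae_restrict_mem measurableSet_Ioi] with t ht
    exact inv_nonneg.2 (le_of_lt ht)

/-- A strict form of Hölder's inequality. -/
lemma integral_rpow_mul_rpow_lt {Z : Type*} [MeasurableSpace Z] {ρ : Measure Z} {P R : Z → ℝ}
    (hP : Integrable P ρ) (hR : Integrable R ρ) (hP0 : 0 ≤ᵐ[ρ] P) (hR0 : 0 ≤ᵐ[ρ] R)
    {a b : ℝ} (ha : 0 < a) (hb : 0 < b) (hab : a + b = 1)
    (hPpos : 0 < ∫ z, P z ∂ρ) (hRpos : 0 < ∫ z, R z ∂ρ)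
    (hne : ¬ ∀ᵐ z ∂ρ, P z / (∫ z, P z ∂ρ) = R z / (∫ z, R z ∂ρ)) :
    Integrable (fun z => P z ^ a * R z ^ b) ρ ∧
      ∫ z, P z ^ a * R z ^ b ∂ρ < (∫ z, P z ∂ρ) ^ a * (∫ z, R z ∂ρ) ^ b := by
  set A := ∫ z, P z ∂ρ with hA
  set B := ∫ z, R z ∂ρ with hB
  have hM : 0 < A ^ a * B ^ b := by positivity
  set N : Z → ℝ := fun z => (P z / A) ^ a * (R z / B) ^ b with hN
  set Y : Z → ℝ := fun z => a * (P z / A) + b * (R z / B) with hY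
  have hYi : Integrable Y ρ := ((hP.div_const A).const_mul a).add ((hR.div_const B).const_mul b)
  have hNm : AEStronglyMeasurable N ρ :=
    (((hP.aemeasurable.div_const A).pow_const a).mul
      ((hR.aemeasurable.div_const B).pow_const b)).aestronglyMeasurable
  have hNY : N ≤ᵐ[ρ] Y := by
    filter_upwards [hP0, hR0] with z h1 h2
    exact geom_mean_le_arith_mean2_weighted ha.le hb.le (div_nonneg h1 hPpos.le)
      (div_nonneg h2 hRpos.le) hab
  have hN0 : 0 ≤ᵐ[ρ] N := by
    filter_upwards [hP0, hR0] with z h1 h2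
    exact mul_nonneg (rpow_nonneg (div_nonneg h1 hPpos.le) _)
      (rpow_nonneg (div_nonneg h2 hRpos.le) _)
  have hNi : Integrable N ρ := by
    refine hYi.mono' hNm ?_
    filter_upwards [hN0, hNY] with z h1 h2
    rwa [norm_of_nonneg h1]
  have hYint : ∫ z, Y z ∂ρ = 1 := by
    rw [hY, integral_add ((hP.div_const A).const_mul a) ((hR.div_const B).const_mul b),
      integral_const_mul, integral_const_mul, integral_div, integral_div, ← hA, ← hB,
      div_self hPpos.ne', div_self hRpos.ne', mul_one, mul_one, hab]
  have hNlt : ∫ z, N z ∂ρ < 1 := by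
    rw [← hYint]
    refine lt_of_le_of_ne (integral_mono_ae hNi hYi hNY) fun heq => hne ?_
    have h := (integral_eq_iff_of_ae_le hNi hYi hNY).1 heq
    filter_upwards [h, hP0, hR0] with z hz h1 h2
    exact (geom_mean_eq_arith_mean2_weighted_iff_of_pos ha hb (div_nonneg h1 hPpos.le)
      (div_nonneg h2 hRpos.le) hab).1 hz
  have hfac : (fun z => P z ^ a * R z ^ b) =ᵐ[ρ] fun z => A ^ a * B ^ b * N z := by
    filter_upwards [hP0, hR0] with z h1 h2
    simp only [hN]
    rw [div_rpow h1 hPpos.le, div_rpow h2 hRpos.le]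
    field_simp
  refine ⟨(hNi.const_mul _).congr hfac.symm, ?_⟩
  rw [integral_congr_ae hfac, integral_const_mul]
  exact mul_lt_of_lt_one_right hM hNlt

lemma integrable_and_integral_eq_of_lintegral {Z : Type*} [MeasurableSpace Z] {ρ : Measure Z}
    {P : Z → ℝ} (hP : AEStronglyMeasurable P ρ) (hP0 : 0 ≤ᵐ[ρ] P) {c : ℝ} (hc : 0 ≤ c)
    (h : ∫⁻ z, ENNReal.ofReal (P z) ∂ρ = ENNReal.ofReal c) :
    Integrable P ρ ∧ ∫ z, P z ∂ρ = c := by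
  refine ⟨⟨hP, ?_⟩, ?_⟩
  · rw [hasFiniteIntegral_iff_ofReal hP0, h]
    exact ENNReal.ofReal_lt_top
  · rw [integral_eq_lintegral_of_nonneg_ae hP0 hP, h, ENNReal.toReal_ofReal hc]

lemma rpow_mul_rpow_weights {p q σ k l κ u v a b : ℝ} (hp : 0 < p) (hq : 0 < q)
    (hpq : 1 / p + 1 / q = 1) (hκ : 0 < κ) (hu : 0 < u) (hv : 0 < v) (ha : 0 ≤ a) (hb : 0 ≤ b) :
    (κ * v ^ (-σ - l) * (u ^ (p * (k - σ) - k) * a ^ p * u ^ σ)) ^ (1 / p) *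
      (κ * u ^ (σ - k) * (v ^ (q * (l + σ) - l) * b ^ q * v ^ (-σ))) ^ (1 / q) = κ * a * b := by
  have hp' : p * (1 / p) = 1 := mul_one_div_cancel hp.ne'
  have hq' : q * (1 / q) = 1 := mul_one_div_cancel hq.ne'
  have hκ1 : κ ^ (1 / p) * κ ^ (1 / q) = κ := by rw [← rpow_add hκ, hpq, rpow_one]
  have hu1 : u ^ ((p * (k - σ) - k) * (1 / p)) * u ^ (σ * (1 / p)) * u ^ ((σ - k) * (1 / q)) =
      1 := by
    rw [← rpow_add hu, ← rpow_add hu]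
    convert rpow_zero u using 2
    linear_combination (k - σ) * hp' - (k - σ) * hpq
  have hv1 : v ^ ((q * (l + σ) - l) * (1 / q)) * v ^ (-σ * (1 / q)) *
      v ^ ((-σ - l) * (1 / p)) = 1 := by
    rw [← rpow_add hv, ← rpow_add hv]
    convert rpow_zero v using 2
    linear_combination (l + σ) * hq' - (l + σ) * hpq
  rw [mul_rpow (by positivity) (by positivity), mul_rpow (by positivity) (by positivity),
    mul_rpow (by positivity) (by positivity), mul_rpow (by positivity) (by positivity),
    mul_rpow (by positivity) (by positivity), mul_rpow (by positivity) (by positivity),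
    mul_rpow (by positivity) (by positivity), mul_rpow (by positivity) (by positivity),
    ← rpow_mul hv.le, ← rpow_mul hv.le, ← rpow_mul hv.le, ← rpow_mul hu.le, ← rpow_mul hu.le,
    ← rpow_mul hu.le, ← rpow_mul ha, ← rpow_mul hb, hp', hq', rpow_one, rpow_one]
  calc _ = (κ ^ (1 / p) * κ ^ (1 / q)) *
        (u ^ ((p * (k - σ) - k) * (1 / p)) * u ^ (σ * (1 / p)) * u ^ ((σ - k) * (1 / q))) *
        (v ^ ((q * (l + σ) - l) * (1 / q)) * v ^ (-σ * (1 / q)) * v ^ ((-σ - l) * (1 / p))) *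
        (a * b) := by ring
    _ = κ * a * b := by rw [hκ1, hu1, hv1]; ring

theorem stmt_14 (m n : ℕ) (hm : 0 < m) (hn : 0 < n) (α β σ p q : ℝ)
    (hα : 0 < α) (hβ : 0 < β) (hσ : 1 < σ) (hp : 1 < p) (hpq : 1 / p + 1 / q = 1)
    (f : (Fin m → ℝ) → ℝ) (g : (Fin n → ℝ) → ℝ)
    (hf : Measurable f) (hg : Measurable g)
    (hf0 : ∀ x, 0 ≤ f x) (hg0 : ∀ y, 0 ≤ g y)
    (hfi : IntegrableOn (fun x => pnorm α x ^ (p * (m - σ) - m) * f x ^ p)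
      {x : Fin m → ℝ | ∀ i, 0 < x i} volume)
    (hfpos : 0 < ∫ x in {x : Fin m → ℝ | ∀ i, 0 < x i},
      pnorm α x ^ (p * (m - σ) - m) * f x ^ p)
    (hgi : IntegrableOn (fun y => pnorm β y ^ (q * (n + σ) - n) * g y ^ q)
      {y : Fin n → ℝ | ∀ i, 0 < y i} volume)
    (hgpos : 0 < ∫ y in {y : Fin n → ℝ | ∀ i, 0 < y i},
      pnorm β y ^ (q * (n + σ) - n) * g y ^ q) :
    ∫ y in {y : Fin n → ℝ | ∀ i, 0 < y i}, ∫ x in {x : Fin m → ℝ | ∀ i, 0 < x i},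
        (cothR (pnorm α x / pnorm β y) - 1) * f x * g y <
      (Real.Gamma (1 / β) ^ n / (β ^ (n - 1) * Real.Gamma (n / β))) ^ (1 / p) *
        (Real.Gamma (1 / α) ^ m / (α ^ (m - 1) * Real.Gamma (m / α))) ^ (1 / q) *
        (Real.Gamma σ / 2 ^ (σ - 1)) * zetaR σ *
        ((∫ x in {x : Fin m → ℝ | ∀ i, 0 < x i},
            pnorm α x ^ (p * (m - σ) - m) * f x ^ p) ^ (1 / p) *
          (∫ y in {y : Fin n → ℝ | ∀ i, 0 < y i},
            pnorm β y ^ (q * (n + σ) - n) * g y ^ q) ^ (1 / q)) := by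
  have hp0 : 0 < p := by linarith
  have hq1 : 0 < 1 / q := by
    have : 1 / p < 1 := (div_lt_one hp0).2 hp
    linarith
  have hq0 : 0 < q := one_div_pos.1 hq1
  have hcoth := measurable_cothR
  have hpα : Measurable (pnorm α : (Fin m → ℝ) → ℝ) := measurable_pnorm α
  have hpβ : Measurable (pnorm β : (Fin n → ℝ) → ℝ) := measurable_pnorm β
  set F : (Fin m → ℝ) → ℝ := fun x => pnorm α x ^ (p * (m - σ) - m) * f x ^ p with hF
  set G : (Fin n → ℝ) → ℝ := fun y => pnorm β y ^ (q * (n + σ) - n) * g y ^ q with hG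
  change Integrable F (volume.restrict (posOrthant m)) at hfi
  change Integrable G (volume.restrict (posOrthant n)) at hgi
  change 0 < ∫ x in posOrthant m, F x at hfpos
  change 0 < ∫ y in posOrthant n, G y at hgpos
  change ∫ y in posOrthant n, ∫ x in posOrthant m,
      (cothR (pnorm α x / pnorm β y) - 1) * f x * g y <
    sphereConst n β ^ (1 / p) * sphereConst m α ^ (1 / q) * (Gamma σ / 2 ^ (σ - 1)) * zetaR σ *
      ((∫ x in posOrthant m, F x) ^ (1 / p) * (∫ y in posOrthant n, G y) ^ (1 / q))
  set μ : Measure (Fin m → ℝ) := volume.restrict (posOrthant m) with hμ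
  set ν : Measure (Fin n → ℝ) := volume.restrict (posOrthant n) with hν
  have hFm : Measurable F := by fun_prop
  have hGm : Measurable G := by fun_prop
  have hμpos : ∀ᵐ x ∂μ, 0 < pnorm α x := by
    filter_upwards [ae_restrict_mem (measurableSet_posOrthant m)] with x hx
    exact pnorm_pos hm α hx
  have hνpos : ∀ᵐ y ∂ν, 0 < pnorm β y := by
    filter_upwards [ae_restrict_mem (measurableSet_posOrthant n)] with y hy
    exact pnorm_pos hn β hy
  have hprodpos : ∀ᵐ z ∂μ.prod ν, 0 < pnorm α z.1 ∧ 0 < pnorm β z.2 :=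
    (Measure.quasiMeasurePreserving_fst.ae hμpos).and
      (Measure.quasiMeasurePreserving_snd.ae hνpos)
  have hF0 {x : Fin m → ℝ} (hx : 0 < pnorm α x) : 0 ≤ F x :=
    mul_nonneg (rpow_nonneg hx.le _) (rpow_nonneg (hf0 x) _)
  have hG0 {y : Fin n → ℝ} (hy : 0 < pnorm β y) : 0 ≤ G y :=
    mul_nonneg (rpow_nonneg hy.le _) (rpow_nonneg (hg0 y) _)
  have hCm := sphereConst_pos hm hα
  have hCn := sphereConst_pos hn hβ
  have hJ := cothMellin_pos hσ
  set P : (Fin m → ℝ) × (Fin n → ℝ) → ℝ := fun z =>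
    (cothR (pnorm α z.1 / pnorm β z.2) - 1) * pnorm β z.2 ^ (-σ - n) *
      (F z.1 * pnorm α z.1 ^ σ) with hPdef
  set R : (Fin m → ℝ) × (Fin n → ℝ) → ℝ := fun z =>
    (cothR (pnorm α z.1 / pnorm β z.2) - 1) * pnorm α z.1 ^ (σ - m) *
      (G z.2 * pnorm β z.2 ^ (-σ)) with hRdef
  have hPm : Measurable P := by fun_prop
  have hRm : Measurable R := by fun_prop
  have hP0 : 0 ≤ᵐ[μ.prod ν] P := by
    filter_upwards [hprodpos] with z ⟨hu, hv⟩
    have := cothR_sub_one_pos_s14 (div_pos hu hv)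
    have := hF0 hu
    simp only [hPdef, Pi.zero_apply]
    positivity
  have hR0 : 0 ≤ᵐ[μ.prod ν] R := by
    filter_upwards [hprodpos] with z ⟨hu, hv⟩
    have := cothR_sub_one_pos_s14 (div_pos hu hv)
    have := hG0 hv
    simp only [hRdef, Pi.zero_apply]
    positivity
  obtain ⟨hPi, hPint⟩ := integrable_and_integral_eq_of_lintegral hPm.aestronglyMeasurable hP0
    (c := sphereConst n β * cothMellin σ * ∫ x, F x ∂μ) (by positivity) (by
      rw [lintegral_prod _ (by fun_prop), ENNReal.ofReal_mul (by positivity),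
        ofReal_integral_eq_lintegral_ofReal hfi (hμpos.mono fun x hx => hF0 hx),
        ← lintegral_const_mul _ (by fun_prop)]
      refine lintegral_congr_ae ?_
      filter_upwards [hμpos] with x hx
      have h0 : 0 ≤ F x * pnorm α x ^ σ := mul_nonneg (hF0 hx) (rpow_nonneg hx.le _)
      simp only [hPdef]
      simp_rw [ENNReal.ofReal_mul' h0]
      rw [lintegral_mul_const' _ _ ENNReal.ofReal_ne_top, lintegral_cothR_div_pnorm hσ hn hβ hx,
        ← ENNReal.ofReal_mul (by positivity), ← ENNReal.ofReal_mul (by positivity)]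
      congr 1
      have h1 : pnorm α x ^ (-σ) * pnorm α x ^ σ = 1 := by
        rw [← rpow_add hx, neg_add_cancel, rpow_zero]
      linear_combination sphereConst n β * cothMellin σ * F x * h1)
  obtain ⟨hRi, hRint⟩ := integrable_and_integral_eq_of_lintegral hRm.aestronglyMeasurable hR0
    (c := sphereConst m α * cothMellin σ * ∫ y, G y ∂ν) (by positivity) (by
      rw [lintegral_prod_symm _ (by fun_prop), ENNReal.ofReal_mul (by positivity),
        ofReal_integral_eq_lintegral_ofReal hgi (hνpos.mono fun y hy => hG0 hy),
        ← lintegral_const_mul _ (by fun_prop)]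
      refine lintegral_congr_ae ?_
      filter_upwards [hνpos] with y hy
      have h0 : 0 ≤ G y * pnorm β y ^ (-σ) := mul_nonneg (hG0 hy) (rpow_nonneg hy.le _)
      simp only [hRdef]
      simp_rw [ENNReal.ofReal_mul' h0]
      rw [lintegral_mul_const' _ _ ENNReal.ofReal_ne_top, lintegral_cothR_pnorm_div hσ hm hα hy,
        ← ENNReal.ofReal_mul (by positivity), ← ENNReal.ofReal_mul (by positivity)]
      congr 1
      have h1 : pnorm β y ^ σ * pnorm β y ^ (-σ) = 1 := by
        rw [← rpow_add hy, add_neg_cancel, rpow_zero]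
      linear_combination sphereConst m α * cothMellin σ * G y * h1)
  have hne : ¬ ∀ᵐ z ∂μ.prod ν,
      P z / (∫ z, P z ∂μ.prod ν) = R z / (∫ z, R z ∂μ.prod ν) := by
    intro h
    have hPpos : 0 < ∫ z, P z ∂μ.prod ν := by rw [hPint]; positivity
    have hRpos : 0 < ∫ z, R z ∂μ.prod ν := by rw [hRint]; positivity
    have hμ0 : NeZero μ := ⟨by rintro h0; simp [h0] at hfpos⟩
    obtain ⟨x, hx, hxy⟩ := (hμpos.and (Measure.ae_ae_of_ae_prod h)).exists
    set A := ∫ z, P z ∂μ.prod ν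
    set B := ∫ z, R z ∂μ.prod ν
    set c := F x * pnorm α x ^ (m : ℝ) * B / A with hc
    have hGc : G =ᵐ[ν] fun y => c * pnorm β y ^ (-n : ℝ) := by
      filter_upwards [hxy, hνpos] with y h1 hy
      have hκ := cothR_sub_one_pos_s14 (div_pos hx hy)
      simp only [hPdef, hRdef] at h1
      rw [sub_eq_add_neg (-σ), rpow_add hy, rpow_sub hx] at h1
      have hyσ : 0 < pnorm β y ^ (-σ) := rpow_pos_of_pos hy _
      have hxσ : 0 < pnorm α x ^ σ := rpow_pos_of_pos hx _
      have hxm : 0 < pnorm α x ^ (m : ℝ) := rpow_pos_of_pos hx _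
      rw [hc]
      refine mul_left_cancel₀ (mul_pos (mul_pos (mul_pos hκ hyσ) hxσ)
        (mul_pos (inv_pos.2 hxm) (inv_pos.2 hRpos))).ne' ?_
      calc _ = _ := by ring
        _ = _ := h1.symm
        _ = _ := by field_simp
    have hc0 : c ≠ 0 := by
      intro h0
      rw [integral_congr_ae hGc, h0] at hgpos
      simp at hgpos
    refine not_integrableOn_pnorm_rpow hn hβ (((hgi.congr hGc).const_mul c⁻¹).congr ?_)
    exact Filter.Eventually.of_forall fun y => inv_mul_cancel_left₀ hc0 _
  obtain ⟨hi, hlt⟩ := integral_rpow_mul_rpow_lt hPi hRi hP0 hR0 (one_div_pos.2 hp0) hq1 hpq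
    (by rw [hPint]; positivity) (by rw [hRint]; positivity) hne
  have hprod : (fun z => P z ^ (1 / p) * R z ^ (1 / q)) =ᵐ[μ.prod ν]
      fun z => (cothR (pnorm α z.1 / pnorm β z.2) - 1) * f z.1 * g z.2 := by
    filter_upwards [hprodpos] with z ⟨hu, hv⟩
    exact rpow_mul_rpow_weights hp0 hq0 hpq (cothR_sub_one_pos_s14 (div_pos hu hv)) hu hv
      (hf0 _) (hg0 _)
  rw [integral_congr_ae hprod, integral_prod_symm _ (hi.congr hprod), hPint, hRint] at hlt
  refine hlt.trans_eq ?_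
  have hJ1 : cothMellin σ ^ (1 / p) * cothMellin σ ^ (1 / q) = cothMellin σ := by
    rw [← rpow_add hJ, hpq, rpow_one]
  rw [mul_rpow (by positivity) hfpos.le, mul_rpow (by positivity) hgpos.le,
    mul_rpow hCn.le hJ.le, mul_rpow hCm.le hJ.le, mul_assoc _ (Gamma σ / 2 ^ (σ - 1)),
    ← cothMellin]
  linear_combination sphereConst n β ^ (1 / p) * sphereConst m α ^ (1 / q) *
    (∫ x, F x ∂μ) ^ (1 / p) * (∫ y, G y ∂ν) ^ (1 / q) * hJ1
end
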